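/- Strict convexity of the cumulant generating function: for n ≥ 1, define for η < 0 the function ψ(η) = log ∫_{ℝⁿ} exp( η Σᵢ rᵢ² ) Π_{i<j} sinh⁴( |rᵢ − rⱼ| / 2 ) dr₁⋯drₙ (the integral being finite for every η < 0). Then ψ is strictly convex on the interval (−∞, 0). -/

import Mathlib

open MeasureTheory

/-- The logarithm of the Laplace integral `∫ exp(η T) w` is strictly convex wherever the integral
converges, provided `T` is not constant on the set where the weight `w` is positive. -/
theorem strictConvexOn_log_integral_exp_mul {X : Type*} [TopologicalSpace X] [MeasurableSpace X]
    {μ : Measure X} [μ.IsOpenPosMeasure] {T w : X → ℝ} {s : Set ℝ}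
    (hs : Convex ℝ s) (hT : Continuous T) (hw : Continuous w) (hw0 : ∀ r, 0 ≤ w r)
    (hint : ∀ η ∈ s, Integrable (fun r => Real.exp (η * T r) * w r) μ)
    (hne : ∀ c, ∃ r, 0 < w r ∧ T r ≠ c) :
    StrictConvexOn ℝ s (fun η => Real.log (∫ r, Real.exp (η * T r) * w r ∂μ)) := by
  set Z : ℝ → ℝ := fun η => ∫ r, Real.exp (η * T r) * w r ∂μ
  have hpos : ∀ η ∈ s, 0 < Z η := by
    intro η hη
    have hcont : Continuous fun r => Real.exp (η * T r) * w r := by fun_prop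
    refine (integral_pos_iff_support_of_nonneg
      (fun r => mul_nonneg (Real.exp_pos _).le (hw0 r)) (hint η hη)).2 ?_
    obtain ⟨r, hr, -⟩ := hne 0
    exact hcont.isOpen_support.measure_pos μ ⟨r, (mul_pos (Real.exp_pos _) hr).ne'⟩
  refine ⟨hs, fun x hx y hy hxy a b ha hb hab => ?_⟩
  have hz : a * x + b * y ∈ s := hs hx hy ha.le hb.le hab
  simp only [smul_eq_mul]
  change Real.log (Z (a * x + b * y)) < a * Real.log (Z x) + b * Real.log (Z y)
  set p := Real.log (Z x)
  set q := Real.log (Z y)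
  have hone : ∀ η ∈ s, Real.exp (-Real.log (Z η)) * Z η = 1 := by
    intro η hη
    rw [Real.exp_neg, Real.exp_log (hpos η hη), inv_mul_cancel₀ (hpos η hη).ne']
  set F : X → ℝ := fun r =>
    (a * (Real.exp (-p) * (Real.exp (x * T r) * w r)) +
      b * (Real.exp (-q) * (Real.exp (y * T r) * w r))) -
      Real.exp (-(a * p + b * q)) * (Real.exp ((a * x + b * y) * T r) * w r) with hF
  have hix := ((hint x hx).const_mul (Real.exp (-p))).const_mul a
  have hiy := ((hint y hy).const_mul (Real.exp (-q))).const_mul b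
  have hiz := (hint _ hz).const_mul (Real.exp (-(a * p + b * q)))
  have hFeq : ∀ r, F r = (a * Real.exp (x * T r - p) + b * Real.exp (y * T r - q) -
      Real.exp (a * (x * T r - p) + b * (y * T r - q))) * w r := by
    intro r
    have h : a * (x * T r - p) + b * (y * T r - q) =
      -(a * p + b * q) + (a * x + b * y) * T r := by ring
    rw [h, Real.exp_add, sub_eq_add_neg (x * T r), sub_eq_add_neg (y * T r), Real.exp_add,
      Real.exp_add]
    simp only [hF]
    ring
  have hF0 : ∀ r, 0 ≤ F r := by
    intro r
    rw [hFeq]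
    refine mul_nonneg (sub_nonneg.2 ?_) (hw0 r)
    simpa using convexOn_exp.2 (Set.mem_univ (x * T r - p)) (Set.mem_univ (y * T r - q))
      ha.le hb.le hab
  have hFint : Integrable F μ := (hix.add hiy).sub hiz
  have hFcont : Continuous F := by fun_prop
  have hFpos : 0 < ∫ r, F r ∂μ := by
    refine (integral_pos_iff_support_of_nonneg hF0 hFint).2 ?_
    obtain ⟨r, hr, hTr⟩ := hne ((p - q) / (x - y))
    refine hFcont.isOpen_support.measure_pos μ ⟨r, ne_of_gt ?_⟩
    rw [hFeq]
    refine mul_pos (sub_pos.2 ?_) hr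
    have huv : x * T r - p ≠ y * T r - q := by
      intro h
      apply hTr
      rw [eq_div_iff (sub_ne_zero.2 hxy)]
      linarith
    simpa using strictConvexOn_exp.2 (Set.mem_univ (x * T r - p)) (Set.mem_univ (y * T r - q))
      huv ha hb hab
  have hval : ∫ r, F r ∂μ = 1 - Real.exp (-(a * p + b * q)) * Z (a * x + b * y) := by
    refine (integral_sub (hix.add hiy) hiz).trans ?_
    rw [integral_add' hix hiy, integral_const_mul, integral_const_mul, integral_const_mul,
      integral_const_mul, integral_const_mul, hone x hx, hone y hy, mul_one, mul_one, hab]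
  rw [hval, Real.exp_neg, sub_pos, inv_mul_lt_one₀ (Real.exp_pos _)] at hFpos
  exact (Real.log_lt_iff_lt_exp (hpos _ hz)).2 hFpos

/-- A Gaussian factor dominates a factor growing exponentially in `|x|`. -/
theorem integrable_exp_mul_sq_add_mul_abs {η : ℝ} (hη : η < 0) (c : ℝ) :
    Integrable fun x : ℝ => Real.exp (η * x ^ 2 + c * |x|) := by
  have hg := (integrable_exp_neg_mul_sq (b := -η / 2) (by linarith)).const_mul
    (Real.exp (c ^ 2 / (-2 * η)))
  refine hg.mono' (by fun_prop) (Filter.Eventually.of_forall fun x => ?_)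
  rw [Real.norm_of_nonneg (Real.exp_pos _).le, ← Real.exp_add, Real.exp_le_exp]
  have h : c ^ 2 / (-2 * η) + -(-η / 2) * x ^ 2 - (η * x ^ 2 + c * |x|) =
      (η * |x| + c) ^ 2 / (-2 * η) := by
    have hη0 := hη.ne
    rw [← sq_abs x]
    field_simp
    ring
  have h0 : 0 ≤ (η * |x| + c) ^ 2 / (-2 * η) := div_nonneg (sq_nonneg _) (by linarith)
  linarith

theorem sinh_half_abs_sub_pow_four_le {n : ℕ} (r : Fin n → ℝ) {i j : Fin n} (hij : i ≠ j) :
    Real.sinh (|r i - r j| / 2) ^ 4 ≤ Real.exp (2 * ∑ k, |r k|) := by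
  have h0 : 0 ≤ Real.sinh (|r i - r j| / 2) := Real.sinh_nonneg_iff.2 (by positivity)
  have h1 : Real.sinh (|r i - r j| / 2) ≤ Real.exp (|r i - r j| / 2) := by
    rw [Real.sinh_eq]
    linarith [Real.exp_pos (|r i - r j| / 2), Real.exp_pos (-(|r i - r j| / 2))]
  have h2 : |r i| + |r j| ≤ ∑ k, |r k| := by
    rw [← Finset.sum_pair (f := fun k => |r k|) hij]
    exact Finset.sum_le_univ_sum_of_nonneg fun k => abs_nonneg _
  calc Real.sinh (|r i - r j| / 2) ^ 4 ≤ Real.exp (|r i - r j| / 2) ^ 4 := by gcongr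
    _ = Real.exp (2 * |r i - r j|) := by
      rw [← Real.exp_nat_mul]
      congr 1
      push_cast
      ring
    _ ≤ Real.exp (2 * ∑ k, |r k|) := by
      gcongr
      exact (abs_sub _ _).trans h2

theorem integrable_exp_mul_sum_sq_mul_prod_sinh (n : ℕ) {η : ℝ} (hη : η < 0) :
    Integrable fun r : Fin n → ℝ =>
      Real.exp (η * ∑ i, r i ^ 2) *
        ∏ p ∈ Finset.univ.filter (fun p : Fin n × Fin n => p.1 < p.2),
          Real.sinh (|r p.1 - r p.2| / 2) ^ 4 := by
  set P := Finset.univ.filter (fun p : Fin n × Fin n => p.1 < p.2)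
  have hg : Integrable fun r : Fin n → ℝ =>
      ∏ i, Real.exp (η * r i ^ 2 + (2 * P.card) * |r i|) :=
    Integrable.fintype_prod fun _ => integrable_exp_mul_sq_add_mul_abs hη _
  refine hg.mono' (Continuous.aestronglyMeasurable (by fun_prop))
    (Filter.Eventually.of_forall fun r => ?_)
  rw [Real.norm_of_nonneg (by positivity), ← Real.exp_sum, Finset.sum_add_distrib,
    ← Finset.mul_sum, ← Finset.mul_sum, Real.exp_add]
  gcongr
  calc ∏ p ∈ P, Real.sinh (|r p.1 - r p.2| / 2) ^ 4
      ≤ ∏ _p ∈ P, Real.exp (2 * ∑ k, |r k|) :=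
        Finset.prod_le_prod (fun p _ => by positivity) fun p hp =>
          sinh_half_abs_sub_pow_four_le r (Finset.mem_filter.1 hp).2.ne
    _ = Real.exp (2 * P.card * ∑ k, |r k|) := by
      rw [Finset.prod_const, ← Real.exp_nat_mul]
      congr 1
      ring

/-- Strict convexity of the cumulant generating function: for `n ≥ 1`, the function
`ψ(η) = log ∫_{ℝⁿ} exp(η Σᵢ rᵢ²) Π_{i<j} sinh⁴(|rᵢ − rⱼ|/2) dr` is strictly convex on
the interval `(−∞, 0)`. -/
theorem cumulant_generating_function_strictConvexOn (n : ℕ) (hn : 1 ≤ n) :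
    StrictConvexOn ℝ (Set.Iio (0 : ℝ))
      (fun η : ℝ =>
        Real.log
          (∫ r : Fin n → ℝ,
            Real.exp (η * ∑ i, r i ^ 2) *
              ∏ p ∈ Finset.univ.filter (fun p : Fin n × Fin n => p.1 < p.2),
                Real.sinh (|r p.1 - r p.2| / 2) ^ 4)) := by
  refine strictConvexOn_log_integral_exp_mul (convex_Iio 0) (by fun_prop) (by fun_prop)
    (fun r => by positivity) (fun η hη => integrable_exp_mul_sum_sq_mul_prod_sinh n hη)
    fun c => ?_
  have hw : ∀ t : ℝ, 0 < t → 0 < ∏ p ∈ Finset.univ.filter (fun p : Fin n × Fin n => p.1 < p.2),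
      Real.sinh (|t * ((p.1 : ℝ) + 1) - t * ((p.2 : ℝ) + 1)| / 2) ^ 4 := by
    intro t ht
    refine Finset.prod_pos fun p hp => pow_pos (Real.sinh_pos_iff.2 (half_pos (abs_pos.2 ?_))) 4
    have h : ((p.1 : ℕ) : ℝ) < (p.2 : ℕ) := by exact_mod_cast (Finset.mem_filter.1 hp).2
    nlinarith
  have hS : 0 < ∑ i : Fin n, ((i : ℝ) + 1) ^ 2 :=
    Finset.sum_pos (fun i _ => by positivity) ⟨⟨0, hn⟩, Finset.mem_univ _⟩
  by_contra! h
  have h1 := h (fun i => 1 * ((i : ℝ) + 1)) (hw 1 one_pos)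
  have h2 := h (fun i => 2 * ((i : ℝ) + 1)) (hw 2 two_pos)
  simp only [mul_pow, ← Finset.mul_sum] at h1 h2
  linarith
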